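/- Let A be a split regular BiHom-Poisson superalgebra with root system Λ such that H = Σ_{α∈Λ} ([A_{α∘ψ⁻¹}, A_{−α∘φ⁻¹}] + A_{α∘ψ⁻¹}·A_{−α∘φ⁻¹}). If I is an ideal of A with I ⊆ H, then I ⊆ Z(A). -/

import Mathlib

/-- A (regular, with distinguished maximal abelian graded subalgebra `H`)
BiHom-Poisson superalgebra over a field `K`. -/
structure BHPS (K A : Type*) [Field K] [AddCommGroup A] [Module K A] where
  /-- the ℤ₂-grading -/
  grade : ZMod 2 → Submodule K A
  gradeInternal : DirectSum.IsInternal grade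
  /-- the bracket -/
  br : A →ₗ[K] A →ₗ[K] A
  /-- the associative-type product -/
  mu : A →ₗ[K] A →ₗ[K] A
  /-- the first structure map -/
  phi : A ≃ₗ[K] A
  /-- the second structure map -/
  psi : A ≃ₗ[K] A
  br_grade : ∀ (i j : ZMod 2), ∀ x ∈ grade i, ∀ y ∈ grade j, br x y ∈ grade (i + j)
  mu_grade : ∀ (i j : ZMod 2), ∀ x ∈ grade i, ∀ y ∈ grade j, mu x y ∈ grade (i + j)
  phi_grade : ∀ i, (grade i).map (phi : A →ₗ[K] A) = grade i
  psi_grade : ∀ i, (grade i).map (psi : A →ₗ[K] A) = grade i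
  phi_psi_comm : ∀ x, phi (psi x) = psi (phi x)
  phi_br : ∀ x y, phi (br x y) = br (phi x) (phi y)
  psi_br : ∀ x y, psi (br x y) = br (psi x) (psi y)
  phi_mu : ∀ x y, phi (mu x y) = mu (phi x) (phi y)
  psi_mu : ∀ x y, psi (mu x y) = mu (psi x) (psi y)
  skew : ∀ (i j : ZMod 2), ∀ x ∈ grade i, ∀ y ∈ grade j,
    br (psi x) (phi y) = -((-1 : K) ^ (i.val * j.val)) • br (psi y) (phi x)
  jacobi : ∀ (i j k : ZMod 2), ∀ x ∈ grade i, ∀ y ∈ grade j, ∀ z ∈ grade k,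
    ((-1 : K) ^ (i.val * k.val)) • br (psi (psi x)) (br (psi y) (phi z))
      + ((-1 : K) ^ (i.val * j.val)) • br (psi (psi y)) (br (psi z) (phi x))
      + ((-1 : K) ^ (j.val * k.val)) • br (psi (psi z)) (br (psi x) (phi y)) = 0
  assoc : ∀ x y z, mu (phi x) (mu y z) = mu (mu x y) (psi z)
  leibniz : ∀ (j k : ZMod 2), ∀ (x : A), ∀ y ∈ grade j, ∀ z ∈ grade k,
    br (mu x y) (phi (psi z))
      = mu (phi x) (br y (phi z)) + ((-1 : K) ^ (j.val * k.val)) • mu (br x (psi z)) (phi y)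
  /-- the maximal abelian graded subalgebra -/
  H : Submodule K A
  H_graded : H = (H ⊓ grade 0) ⊔ (H ⊓ grade 1)
  H_abelian : ∀ x ∈ H, ∀ y ∈ H, br x y = 0
  phi_H : H.map (phi : A →ₗ[K] A) = H
  psi_H : H.map (psi : A →ₗ[K] A) = H
  H_max : ∀ H' : Submodule K A, H ≤ H' →
    H' = (H' ⊓ grade 0) ⊔ (H' ⊓ grade 1) →
    (∀ x ∈ H', ∀ y ∈ H', br x y = 0) →
    H'.map (phi : A →ₗ[K] A) = H' → H'.map (psi : A →ₗ[K] A) = H' → H' = H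

namespace BHPS

variable {K A : Type*} [Field K] [AddCommGroup A] [Module K A] (D : BHPS K A)

/-- The even part `H₀` of `H`. -/
def H0 : Submodule K A := D.H ⊓ D.grade 0

lemma phi_H0 : D.H0.map (D.phi : A →ₗ[K] A) = D.H0 := by
  unfold H0
  rw [Submodule.map_inf (D.phi : A →ₗ[K] A) D.phi.injective, D.phi_H, D.phi_grade]

lemma psi_H0 : D.H0.map (D.psi : A →ₗ[K] A) = D.H0 := by
  unfold H0
  rw [Submodule.map_inf (D.psi : A →ₗ[K] A) D.psi.injective, D.psi_H, D.psi_grade]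

/-- The restriction of `φ` to `H₀`, as a linear automorphism. -/
def phiH0 : ↥D.H0 ≃ₗ[K] ↥D.H0 :=
  (D.phi.submoduleMap D.H0).trans (LinearEquiv.ofEq _ _ D.phi_H0)

/-- The restriction of `ψ` to `H₀`, as a linear automorphism. -/
def psiH0 : ↥D.H0 ≃ₗ[K] ↥D.H0 :=
  (D.psi.submoduleMap D.H0).trans (LinearEquiv.ofEq _ _ D.psi_H0)

/-- The root space attached to a linear functional `α : H₀ → K`:
`A_α = {v : [h, φ(v)] = α(h) • φψ(v) for all h ∈ H₀}`. -/
def rootSpace (α : Module.Dual K ↥D.H0) : Submodule K A where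
  carrier := {v | ∀ h : ↥D.H0, D.br (h : A) (D.phi v) = α h • D.phi (D.psi v)}
  add_mem' := by
    intro a b ha hb h
    simp only [map_add, ha h, hb h, smul_add]
  zero_mem' := by
    intro h
    simp
  smul_mem' := by
    intro c v hv h
    simp only [map_smul, hv h]
    rw [smul_comm]

/-- The root system `Λ`. -/
def roots : Set (Module.Dual K ↥D.H0) := {α | α ≠ 0 ∧ D.rootSpace α ≠ ⊥}

/-- `A` is split with respect to `H`: `A = H ⊕ (⊕_{α ∈ Λ} A_α)`. -/
def IsSplit : Prop :=
  letI := Classical.decEq (Option ↥D.roots)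
  DirectSum.IsInternal (fun o : Option ↥D.roots => o.elim D.H fun α => D.rootSpace α.1)

/-- `α ∘ φ^{z₁} ∘ ψ^{z₂}`. -/
def twist (z₁ z₂ : ℤ) (γ : Module.Dual K ↥D.H0) : Module.Dual K ↥D.H0 :=
  γ ∘ₗ ((((D.phiH0 ^ z₁) : ↥D.H0 ≃ₗ[K] ↥D.H0) : ↥D.H0 →ₗ[K] ↥D.H0) ∘ₗ
        (((D.psiH0 ^ z₂) : ↥D.H0 ≃ₗ[K] ↥D.H0) : ↥D.H0 →ₗ[K] ↥D.H0))

/-- `±S = S ∪ (-S)`. -/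
def pm (S : Set (Module.Dual K ↥D.H0)) : Set (Module.Dual K ↥D.H0) :=
  S ∪ (Neg.neg '' S)

/-- The partial sums `α₁∘φ^{-i} + α₂∘φ^{-i+1}∘ψ^{-1} + ⋯ + α_i∘φ^{-1}∘ψ^{-1} + α_{i+1}∘ψ^{-1}`
appearing in the definition of a connection. -/
def chainSum (a : ℕ → Module.Dual K ↥D.H0) (i : ℕ) : Module.Dual K ↥D.H0 :=
  D.twist (-(i : ℤ)) 0 (a 1)
    + ∑ t ∈ Finset.Icc 2 (i + 1), D.twist (-((i : ℤ) + 1 - (t : ℤ))) (-1) (a t)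

/-- `a 1, …, a k` is a connection from `α` to `β` (relative to the set of roots `S`). -/
def IsConnectionIn (S : Set (Module.Dual K ↥D.H0)) (α β : Module.Dual K ↥D.H0)
    (k : ℕ) (a : ℕ → Module.Dual K ↥D.H0) : Prop :=
  2 ≤ k ∧
  (∀ t, 1 ≤ t → t ≤ k → a t ∈ D.pm S) ∧
  (∃ n r : ℕ, a 1 = D.twist (-(n : ℤ)) (-(r : ℤ)) α) ∧
  (∀ i, 1 ≤ i → i ≤ k - 2 → D.chainSum a i ∈ D.pm S) ∧
  (∃ m s : ℕ, D.chainSum a (k - 1) = D.twist (-(m : ℤ)) (-(s : ℤ)) β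
      ∨ D.chainSum a (k - 1) = -(D.twist (-(m : ℤ)) (-(s : ℤ)) β))

/-- `α` is connected to `β` (relative to the set of roots `S`). -/
def ConnectedIn (S : Set (Module.Dual K ↥D.H0)) (α β : Module.Dual K ↥D.H0) : Prop :=
  (∃ z₁ z₂ : ℤ, ∃ ε : K, (ε = 1 ∨ ε = -1) ∧ β = ε • D.twist z₁ z₂ α) ∨
  (∃ k a, D.IsConnectionIn S α β k a)

/-- `α` is connected to `β`. -/
def Connected (α β : Module.Dual K ↥D.H0) : Prop := D.ConnectedIn D.roots α β

/-- The set `[α]` of roots connected to `α`. -/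
def classSet (α : Module.Dual K ↥D.H0) : Set (Module.Dual K ↥D.H0) :=
  {β ∈ D.roots | D.Connected α β}

/-- `I_{H,[α]} = span {[A_{β∘ψ⁻¹}, A_{−β∘φ⁻¹}] + A_{β∘ψ⁻¹}·A_{−β∘φ⁻¹} : β ∈ [α]}`. -/
def IH (α : Module.Dual K ↥D.H0) : Submodule K A :=
  ⨆ β ∈ D.classSet α,
    (Submodule.map₂ D.br (D.rootSpace (D.twist 0 (-1) β)) (D.rootSpace (-(D.twist (-1) 0 β)))
      ⊔ Submodule.map₂ D.mu (D.rootSpace (D.twist 0 (-1) β)) (D.rootSpace (-(D.twist (-1) 0 β))))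

/-- `V_{[α]} = ⊕_{β ∈ [α]} A_β`. -/
def VS (α : Module.Dual K ↥D.H0) : Submodule K A :=
  ⨆ β ∈ D.classSet α, D.rootSpace β

/-- `I_{[α]} = I_{H,[α]} ⊕ V_{[α]}`. -/
def Iclass (α : Module.Dual K ↥D.H0) : Submodule K A := D.IH α ⊔ D.VS α

/-- `J` is an ideal of the (sub)algebra `I`. -/
def IsIdealIn (J I : Submodule K A) : Prop :=
  J ≤ I ∧ J = (J ⊓ D.grade 0) ⊔ (J ⊓ D.grade 1) ∧
  Submodule.map₂ D.br J I ≤ J ∧ Submodule.map₂ D.mu J I ≤ J ∧ Submodule.map₂ D.mu I J ≤ J ∧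
  J.map (D.phi : A →ₗ[K] A) = J ∧ J.map (D.psi : A →ₗ[K] A) = J

/-- `I` is an ideal of `A`: `[I,A] + I·A + A·I ⊆ I`, graded and `φ,ψ`-invariant. -/
def IsIdeal (I : Submodule K A) : Prop := D.IsIdealIn I ⊤

/-- `A` is simple: `[A,A] + A·A ≠ 0` and its only ideals are `0` and `A`. -/
def IsSimple : Prop :=
  (Submodule.map₂ D.br ⊤ ⊤ ⊔ Submodule.map₂ D.mu (⊤ : Submodule K A) ⊤ ≠ ⊥) ∧
  ∀ I : Submodule K A, D.IsIdeal I → I = ⊥ ∨ I = ⊤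

/-- The center `Z(A) = {v : [v,A] + v·A + A·v = 0}`. -/
def center : Submodule K A where
  carrier := {v | ∀ w, D.br v w = 0 ∧ D.mu v w = 0 ∧ D.mu w v = 0}
  add_mem' := by
    intro a b ha hb w
    obtain ⟨h1, h2, h3⟩ := ha w
    obtain ⟨g1, g2, g3⟩ := hb w
    simp [map_add, LinearMap.add_apply, h1, h2, h3, g1, g2, g3]
  zero_mem' := by intro w; simp
  smul_mem' := by
    intro c v hv w
    obtain ⟨h1, h2, h3⟩ := hv w
    simp [map_smul, LinearMap.smul_apply, h1, h2, h3]

/-- `Σ_{α∈Λ} ([A_{α∘ψ⁻¹}, A_{−α∘φ⁻¹}] + A_{α∘ψ⁻¹}·A_{−α∘φ⁻¹})`. -/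
def HSum : Submodule K A :=
  ⨆ α ∈ D.roots,
    (Submodule.map₂ D.br (D.rootSpace (D.twist 0 (-1) α)) (D.rootSpace (-(D.twist (-1) 0 α)))
      ⊔ Submodule.map₂ D.mu (D.rootSpace (D.twist 0 (-1) α)) (D.rootSpace (-(D.twist (-1) 0 α))))

/-- The root system is symmetric. -/
def IsSymmetric : Prop := ∀ α ∈ D.roots, -α ∈ D.roots

/-- `A` is root multiplicative. -/
def RootMultiplicative : Prop :=
  ∀ (i j : ZMod 2) (α β : Module.Dual K ↥D.H0), α ∈ D.roots → β ∈ D.roots →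
    D.rootSpace α ⊓ D.grade i ≠ ⊥ → D.rootSpace β ⊓ D.grade j ≠ ⊥ →
    (D.twist 0 (-1) α + D.twist (-1) 0 β) ∈ D.roots →
    D.rootSpace (D.twist 0 (-1) α + D.twist (-1) 0 β) ⊓ D.grade (i + j) ≠ ⊥ →
    Submodule.map₂ D.br (D.rootSpace α ⊓ D.grade i) (D.rootSpace β ⊓ D.grade j)
      ⊔ Submodule.map₂ D.mu (D.rootSpace α ⊓ D.grade i) (D.rootSpace β ⊓ D.grade j) ≠ ⊥

/-- `A` is of maximal length: every nonzero graded root space is one-dimensional. -/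
def MaximalLength : Prop :=
  ∀ (i : ZMod 2), ∀ α ∈ D.roots, D.rootSpace α ⊓ D.grade i ≠ ⊥ →
    Module.rank K ↥(D.rootSpace α ⊓ D.grade i) = 1

end BHPS

namespace BHPS

section Annihilator

variable {K A : Type*} [Field K] [AddCommGroup A] [Module K A] (D : BHPS K A)

/-- The two-sided annihilator of `I` for the product, intersected with its right annihilator for
the bracket. -/
def annihilator (I : Submodule K A) : Submodule K A where
  carrier := {w | ∀ x ∈ I, D.br x w = 0 ∧ D.mu x w = 0 ∧ D.mu w x = 0}
  add_mem' := by
    intro a b ha hb x hx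
    obtain ⟨h1, h2, h3⟩ := ha x hx
    obtain ⟨g1, g2, g3⟩ := hb x hx
    simp [h1, h2, h3, g1, g2, g3]
  zero_mem' := by intro x _; simp
  smul_mem' := by
    intro c v hv x hx
    obtain ⟨h1, h2, h3⟩ := hv x hx
    simp [h1, h2, h3]

variable {D} {I : Submodule K A}

lemma apply_mem_of_map_eq {e : A ≃ₗ[K] A} (h : I.map (e : A →ₗ[K] A) = I) {x : A} (hx : x ∈ I) :
    e x ∈ I :=
  h ▸ Submodule.mem_map_of_mem (f := (e : A →ₗ[K] A)) hx

lemma symm_apply_mem_of_map_eq {e : A ≃ₗ[K] A} (h : I.map (e : A →ₗ[K] A) = I) {x : A}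
    (hx : x ∈ I) : e.symm x ∈ I := by
  rw [← h] at hx
  obtain ⟨y, hy, rfl⟩ := hx
  simpa using hy

lemma exists_eq_add_of_graded (h : I = (I ⊓ D.grade 0) ⊔ (I ⊓ D.grade 1)) {x : A} (hx : x ∈ I) :
    ∃ y ∈ I, ∃ z ∈ I, y ∈ D.grade 0 ∧ z ∈ D.grade 1 ∧ x = y + z := by
  rw [h] at hx
  obtain ⟨y, hy, z, hz, rfl⟩ := Submodule.mem_sup.1 hx
  exact ⟨y, hy.1, z, hz.1, hy.2, hz.2, rfl⟩

variable (D) in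
lemma exists_eq_add (x : A) : ∃ y ∈ D.grade 0, ∃ z ∈ D.grade 1, x = y + z := by
  have hle : (⨆ i, D.grade i) ≤ D.grade 0 ⊔ D.grade 1 := by
    refine iSup_le fun i => ?_
    fin_cases i
    · exact le_sup_left
    · exact le_sup_right
  rw [D.gradeInternal.submodule_iSup_eq_top] at hle
  obtain ⟨y, hy, z, hz, h⟩ := Submodule.mem_sup.1 (hle (Submodule.mem_top (x := x)))
  exact ⟨y, hy, z, hz, h.symm⟩

lemma eq_zero_of_add_eq_zero {i j : ZMod 2} (hij : i ≠ j) {a b : A} (ha : a ∈ D.grade i)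
    (hb : b ∈ D.grade j) (h : a + b = 0) : a = 0 ∧ b = 0 := by
  have hd := D.gradeInternal.submodule_iSupIndep.pairwiseDisjoint hij
  have ha0 : a = 0 := by
    refine Submodule.disjoint_def.1 hd a ha ?_
    rw [eq_neg_of_add_eq_zero_left h]
    exact neg_mem hb
  exact ⟨ha0, by simpa [ha0] using h⟩

lemma phi_symm_mem_grade {i : ZMod 2} {x : A} (hx : x ∈ D.grade i) : D.phi.symm x ∈ D.grade i :=
  symm_apply_mem_of_map_eq (D.phi_grade i) hx

lemma psi_symm_mem_grade {i : ZMod 2} {x : A} (hx : x ∈ D.grade i) : D.psi.symm x ∈ D.grade i :=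
  symm_apply_mem_of_map_eq (D.psi_grade i) hx

lemma apply_mem_annihilator {e : A ≃ₗ[K] A} (he : I.map (e : A →ₗ[K] A) = I)
    (hbr : ∀ x y, e (D.br x y) = D.br (e x) (e y)) (hmu : ∀ x y, e (D.mu x y) = D.mu (e x) (e y))
    {w : A} (hw : w ∈ D.annihilator I) : e w ∈ D.annihilator I := by
  intro x hx
  obtain ⟨h1, h2, h3⟩ := hw _ (symm_apply_mem_of_map_eq he hx)
  have g1 := hbr (e.symm x) w
  have g2 := hmu (e.symm x) w
  have g3 := hmu w (e.symm x)
  simp only [h1, h2, h3, map_zero, e.apply_symm_apply] at g1 g2 g3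
  exact ⟨g1.symm, g2.symm, g3.symm⟩

lemma symm_apply_mem_annihilator {e : A ≃ₗ[K] A} (he : I.map (e : A →ₗ[K] A) = I)
    (hbr : ∀ x y, e (D.br x y) = D.br (e x) (e y)) (hmu : ∀ x y, e (D.mu x y) = D.mu (e x) (e y))
    {w : A} (hw : w ∈ D.annihilator I) : e.symm w ∈ D.annihilator I := by
  intro x hx
  obtain ⟨h1, h2, h3⟩ := hw _ (apply_mem_of_map_eq he hx)
  refine ⟨e.injective ?_, e.injective ?_, e.injective ?_⟩
  · simpa [hbr] using h1
  · simpa [hmu] using h2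
  · simpa [hmu] using h3

lemma exists_eq_add_of_mem_annihilator (hI : D.IsIdeal I) {w : A} (hw : w ∈ D.annihilator I) :
    ∃ y ∈ D.annihilator I, ∃ z ∈ D.annihilator I,
      y ∈ D.grade 0 ∧ z ∈ D.grade 1 ∧ w = y + z := by
  obtain ⟨y, hy, z, hz, rfl⟩ := D.exists_eq_add w
  have key : ∀ i : ZMod 2, ∀ x ∈ I, x ∈ D.grade i →
      (D.br x y = 0 ∧ D.br x z = 0) ∧ (D.mu x y = 0 ∧ D.mu x z = 0) ∧
        (D.mu y x = 0 ∧ D.mu z x = 0) := by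
    intro i x hx hxi
    obtain ⟨h1, h2, h3⟩ := hw x hx
    have hij : i + 0 ≠ i + 1 := by simp
    have hji : 0 + i ≠ 1 + i := by simp
    refine ⟨eq_zero_of_add_eq_zero hij (D.br_grade _ _ _ hxi _ hy) (D.br_grade _ _ _ hxi _ hz) ?_,
      eq_zero_of_add_eq_zero hij (D.mu_grade _ _ _ hxi _ hy) (D.mu_grade _ _ _ hxi _ hz) ?_,
      eq_zero_of_add_eq_zero hji (D.mu_grade _ _ _ hy _ hxi) (D.mu_grade _ _ _ hz _ hxi) ?_⟩
    · rw [← map_add, h1]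
    · rw [← map_add, h2]
    · rw [← LinearMap.add_apply, ← map_add, h3]
  refine ⟨y, fun x hx => ?_, z, fun x hx => ?_, hy, hz, rfl⟩ <;>
  · obtain ⟨x₀, hx₀, x₁, hx₁, hg₀, hg₁, rfl⟩ := exists_eq_add_of_graded hI.2.1 hx
    obtain ⟨⟨h1, h2⟩, ⟨h3, h4⟩, h5, h6⟩ := key 0 x₀ hx₀ hg₀
    obtain ⟨⟨g1, g2⟩, ⟨g3, g4⟩, g5, g6⟩ := key 1 x₁ hx₁ hg₁
    simp [*]

section Ideal

variable (hI : D.IsIdeal I)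
include hI

lemma IsIdeal.br_mem {x : A} (hx : x ∈ I) (w : A) : D.br x w ∈ I :=
  hI.2.2.1 (Submodule.apply_mem_map₂ _ hx Submodule.mem_top)

lemma IsIdeal.mu_mem {x : A} (hx : x ∈ I) (w : A) : D.mu x w ∈ I :=
  hI.2.2.2.1 (Submodule.apply_mem_map₂ _ hx Submodule.mem_top)

lemma IsIdeal.mu_mem' {x : A} (hx : x ∈ I) (w : A) : D.mu w x ∈ I :=
  hI.2.2.2.2.1 (Submodule.apply_mem_map₂ _ Submodule.mem_top hx)

lemma IsIdeal.phi_map : I.map (D.phi : A →ₗ[K] A) = I := hI.2.2.2.2.2.1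

lemma IsIdeal.psi_map : I.map (D.psi : A →ₗ[K] A) = I := hI.2.2.2.2.2.2

end Ideal

lemma br_even_skew {h : A} (hh : h ∈ D.grade 0) (w : A) :
    D.br (D.psi w) (D.phi h) = -D.br (D.psi h) (D.phi w) := by
  obtain ⟨y, hy, z, hz, rfl⟩ := D.exists_eq_add w
  have h0 := D.skew 0 0 y hy h hh
  have h1 := D.skew 1 0 z hz h hh
  simp at h0 h1
  simp [h0, h1, add_comm]

lemma leibniz_even {h : A} (hh : h ∈ D.grade 0) (x w : A) :
    D.br (D.mu x w) (D.phi (D.psi h))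
      = D.mu (D.phi x) (D.br w (D.phi h)) + D.mu (D.br x (D.psi h)) (D.phi w) := by
  obtain ⟨y, hy, z, hz, rfl⟩ := D.exists_eq_add w
  have h0 := D.leibniz 0 0 x y hy h hh
  have h1 := D.leibniz 1 0 x z hz h hh
  simp at h0 h1
  simp [h0, h1]
  abel

lemma br_br_even_eq_zero (hI : D.IsIdeal I) (hIH : I ≤ D.H) {x h : A} (hx : x ∈ I) (hh : h ∈ D.H0)
    (w : A) : D.br (D.psi (D.psi x)) (D.br (D.psi h) (D.phi w)) = 0 := by
  have key : ∀ i j : ZMod 2, ∀ x ∈ I, x ∈ D.grade i → ∀ w ∈ D.grade j,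
      D.br (D.psi (D.psi x)) (D.br (D.psi h) (D.phi w)) = 0 := by
    intro i j x hx hxi w hw
    have hJ := D.jacobi i 0 j x hxi h hh.2 w hw
    have hmem : D.br (D.psi w) (D.phi x) ∈ I := by
      rw [D.skew j i w hw x hxi]
      exact I.smul_mem _ (hI.br_mem (apply_mem_of_map_eq hI.psi_map hx) _)
    have h2 : D.br (D.psi (D.psi h)) (D.br (D.psi w) (D.phi x)) = 0 :=
      D.H_abelian _ (apply_mem_of_map_eq D.psi_H (apply_mem_of_map_eq D.psi_H hh.1)) _
        (hIH hmem)
    have h3 : D.br (D.psi x) (D.phi h) = 0 :=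
      D.H_abelian _ (hIH (apply_mem_of_map_eq hI.psi_map hx)) _
        (apply_mem_of_map_eq D.phi_H hh.1)
    simpa [h2, h3] using hJ
  obtain ⟨x₀, hx₀, x₁, hx₁, hg₀, hg₁, rfl⟩ := exists_eq_add_of_graded hI.2.1 hx
  obtain ⟨y, hy, z, hz, rfl⟩ := D.exists_eq_add w
  simp [key _ _ x₀ hx₀ hg₀ y hy, key _ _ x₀ hx₀ hg₀ z hz, key _ _ x₁ hx₁ hg₁ y hy,
    key _ _ x₁ hx₁ hg₁ z hz]

lemma exists_br_psi_symm_eq {α : Module.Dual K ↥D.H0} (hα : α ≠ 0) :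
    ∃ h ∈ D.H0, ∀ w ∈ D.rootSpace α, D.br h (D.psi.symm w) = w := by
  obtain ⟨h₀, hh₀⟩ : ∃ h, α h ≠ 0 := by
    by_contra! hc
    exact hα (LinearMap.ext hc)
  refine ⟨(α h₀)⁻¹ • D.phi.symm (D.psi.symm h₀), D.H0.smul_mem _
    (symm_apply_mem_of_map_eq D.phi_H0 (symm_apply_mem_of_map_eq D.psi_H0 h₀.2)), fun w hw => ?_⟩
  have := hw h₀
  apply D.psi.injective
  apply D.phi.injective
  simp only [map_smul, LinearMap.smul_apply, D.psi_br, D.phi_br, D.psi.apply_symm_apply]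
  rw [D.phi_psi_comm (D.phi.symm _), D.phi.apply_symm_apply, D.psi.apply_symm_apply, this,
    inv_smul_smul₀ hh₀]

/-- Bracketing by a suitable even element of `H` acts as `φ` on a nonzero root space. -/
lemma exists_br_eq_phi {α : Module.Dual K ↥D.H0} (hα : α ≠ 0) :
    ∃ h ∈ D.H0, ∀ w ∈ D.rootSpace α, D.br w h = D.phi w := by
  obtain ⟨h, hh, H⟩ := D.exists_br_psi_symm_eq hα
  refine ⟨-D.phi (D.phi (D.psi.symm h)), neg_mem (apply_mem_of_map_eq D.phi_H0
    (apply_mem_of_map_eq D.phi_H0 (symm_apply_mem_of_map_eq D.psi_H0 hh))), fun w hw => ?_⟩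
  have hs := D.br_even_skew (apply_mem_of_map_eq D.phi_H0 (symm_apply_mem_of_map_eq D.psi_H0 hh)).2
    (D.psi.symm w)
  rw [D.psi.apply_symm_apply, ← D.phi_psi_comm, D.psi.apply_symm_apply, ← D.phi_br, H w hw] at hs
  rw [map_neg, hs, neg_neg]

lemma rootSpace_le_annihilator (hI : D.IsIdeal I) (hIH : I ≤ D.H) {α : Module.Dual K ↥D.H0}
    (hα : α ≠ 0) : D.rootSpace α ≤ D.annihilator I := by
  intro w hw x hx
  obtain ⟨h, hh, hbr⟩ := D.exists_br_psi_symm_eq hα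
  obtain ⟨k, hk, hphi⟩ := D.exists_br_eq_phi hα
  refine ⟨?_, D.phi.injective ?_, D.phi.injective ?_⟩
  · have := br_br_even_eq_zero hI hIH (symm_apply_mem_of_map_eq hI.psi_map
      (symm_apply_mem_of_map_eq hI.psi_map hx)) (symm_apply_mem_of_map_eq D.psi_H0 hh)
      (D.phi.symm (D.psi.symm w))
    simpa [hbr w hw] using this
  · have hk' := symm_apply_mem_of_map_eq D.phi_H0 hk
    have hL := D.leibniz_even hk'.2 x w
    rw [D.H_abelian _ (hIH (hI.mu_mem hx w)) _
        (apply_mem_of_map_eq D.phi_H (apply_mem_of_map_eq D.psi_H hk'.1)),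
      D.H_abelian _ (hIH hx) _ (apply_mem_of_map_eq D.psi_H hk'.1), D.phi.apply_symm_apply,
      hphi w hw] at hL
    simpa [D.phi_mu] using hL.symm
  · have hk' := symm_apply_mem_of_map_eq D.psi_H0 hk
    have hL := D.leibniz_even hk'.2 w x
    rw [D.H_abelian _ (hIH (hI.mu_mem' hx w)) _
        (apply_mem_of_map_eq D.phi_H (apply_mem_of_map_eq D.psi_H hk'.1)),
      D.H_abelian _ (hIH hx) _ (apply_mem_of_map_eq D.phi_H hk'.1), D.psi.apply_symm_apply,
      hphi w hw] at hL
    simpa [D.phi_mu] using hL.symm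

lemma mu_mu_eq_zero (hI : D.IsIdeal I) {x u v : A} (hx : x ∈ I) (hu : u ∈ D.annihilator I)
    (hv : v ∈ D.annihilator I) : D.mu x (D.mu u v) = 0 ∧ D.mu (D.mu u v) x = 0 := by
  have h1 := D.assoc (D.phi.symm x) u v
  have h2 := D.assoc u v (D.psi.symm x)
  rw [(hu _ (symm_apply_mem_of_map_eq hI.phi_map hx)).2.1] at h1
  rw [(hv _ (symm_apply_mem_of_map_eq hI.psi_map hx)).2.2] at h2
  constructor
  · simpa using h1
  · simpa using h2.symm

lemma mu_br_eq_zero (hI : D.IsIdeal I) {x u v : A} (hx : x ∈ I) (hu : u ∈ D.annihilator I)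
    (hv : v ∈ D.annihilator I) : D.mu x (D.br u v) = 0 := by
  have key : ∀ j k : ZMod 2, ∀ u ∈ D.annihilator I, u ∈ D.grade j → ∀ v ∈ D.annihilator I,
      v ∈ D.grade k → D.mu x (D.br u v) = 0 := by
    intro j k u hu huj v hv hvk
    have hL := D.leibniz j k (D.phi.symm x) u huj (D.phi.symm v) (phi_symm_mem_grade hvk)
    have hx' := symm_apply_mem_of_map_eq hI.phi_map hx
    have hv' := apply_mem_annihilator hI.psi_map D.psi_br D.psi_mu
      (symm_apply_mem_annihilator hI.phi_map D.phi_br D.phi_mu hv)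
    rw [(hu _ hx').2.1, (hv' _ hx').1] at hL
    simpa using hL.symm
  obtain ⟨u₀, hu₀, u₁, hu₁, hg₀, hg₁, rfl⟩ := exists_eq_add_of_mem_annihilator hI hu
  obtain ⟨v₀, hv₀, v₁, hv₁, hk₀, hk₁, rfl⟩ := exists_eq_add_of_mem_annihilator hI hv
  simp [key _ _ u₀ hu₀ hg₀ v₀ hv₀ hk₀, key _ _ u₀ hu₀ hg₀ v₁ hv₁ hk₁,
    key _ _ u₁ hu₁ hg₁ v₀ hv₀ hk₀, key _ _ u₁ hu₁ hg₁ v₁ hv₁ hk₁]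

lemma mu_br_eq_zero' (hI : D.IsIdeal I) {x u v : A} (hx : x ∈ I) (hu : u ∈ D.annihilator I)
    (hv : v ∈ D.annihilator I) : D.mu (D.br u v) x = 0 := by
  have key : ∀ j k : ZMod 2, ∀ x ∈ I, x ∈ D.grade j → ∀ v ∈ D.annihilator I,
      v ∈ D.grade k → D.mu (D.br u v) x = 0 := by
    intro j k x hx hxj v hv hvk
    have hL := D.leibniz j k u (D.phi.symm x) (phi_symm_mem_grade hxj) (D.psi.symm v)
      (psi_symm_mem_grade hvk)
    have hx' := symm_apply_mem_of_map_eq hI.phi_map hx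
    have hv' := apply_mem_annihilator hI.phi_map D.phi_br D.phi_mu
      (symm_apply_mem_annihilator hI.psi_map D.psi_br D.psi_mu hv)
    rw [(hu _ hx').2.2, (hv' _ hx').1] at hL
    simpa using hL.symm
  obtain ⟨x₀, hx₀, x₁, hx₁, hg₀, hg₁, rfl⟩ := exists_eq_add_of_graded hI.2.1 hx
  obtain ⟨v₀, hv₀, v₁, hv₁, hk₀, hk₁, rfl⟩ := exists_eq_add_of_mem_annihilator hI hv
  simp [key _ _ x₀ hx₀ hg₀ v₀ hv₀ hk₀, key _ _ x₀ hx₀ hg₀ v₁ hv₁ hk₁,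
    key _ _ x₁ hx₁ hg₁ v₀ hv₀ hk₀, key _ _ x₁ hx₁ hg₁ v₁ hv₁ hk₁]

lemma twist_ne_zero {γ : Module.Dual K ↥D.H0} (hγ : γ ≠ 0) (z₁ z₂ : ℤ) :
    D.twist z₁ z₂ γ ≠ 0 := by
  intro h
  refine hγ (LinearMap.ext fun x => ?_)
  have := LinearMap.congr_fun h ((D.psiH0 ^ z₂).symm ((D.phiH0 ^ z₁).symm x))
  simpa [twist] using this

lemma H_le_annihilator (hI : D.IsIdeal I) (hIH : I ≤ D.H) (hH : D.H = D.HSum) :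
    D.H ≤ D.annihilator I := by
  intro w hw x hx
  refine ⟨D.H_abelian _ (hIH hx) _ hw, ?_⟩
  suffices hle : D.HSum ≤ LinearMap.ker (D.mu x) ⊓ LinearMap.ker (D.mu.flip x) by
    rw [hH] at hw
    exact hle hw
  refine iSup₂_le fun α hα => sup_le ?_ ?_ <;> refine Submodule.map₂_le.2 fun u hu v hv => ?_
  all_goals
    replace hu := rootSpace_le_annihilator hI hIH (twist_ne_zero hα.1 0 (-1)) hu
    replace hv := rootSpace_le_annihilator hI hIH (neg_ne_zero.2 (twist_ne_zero hα.1 (-1) 0)) hv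
  · exact ⟨mu_br_eq_zero hI hx hu hv, mu_br_eq_zero' hI hx hu hv⟩
  · exact mu_mu_eq_zero hI hx hu hv

end Annihilator

variable {K A : Type*}

/-- if `H = Σ_{α∈Λ}(...)` and `I` is an ideal with `I ⊆ H`, then `I ⊆ Z(A)`. -/
theorem ideal_in_H_central {K A : Type*} [Field K] [AddCommGroup A] [Module K A] (D : BHPS K A)
    (hsplit : D.IsSplit)
    (hH : D.H = D.HSum) (I : Submodule K A) (hI : D.IsIdeal I) (hIH : I ≤ D.H) :
    I ≤ D.center := by
  have htop : (⊤ : Submodule K A) ≤ D.annihilator I := by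
    let := Classical.decEq (Option ↥D.roots)
    rw [← DirectSum.IsInternal.submodule_iSup_eq_top hsplit]
    refine iSup_le fun o => ?_
    cases o with
    | none => exact H_le_annihilator hI hIH hH
    | some α => exact rootSpace_le_annihilator hI hIH α.2.1
  exact fun x hx w => htop Submodule.mem_top x hx

end BHPS
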